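/- arXiv:math/0610396 — 4 statements merged into one kernel-verified Lean document; each statement's English description precedes it below -/
import Mathlib

section
/- Let 𝔪 be an ideal of R and 𝔫 an ideal of S. Suppose A is a k-vector-space basis of R such that the subset A ∩ 𝔪 spans 𝔪 over k, and B is a k-basis of S such that B ∩ 𝔫 spans 𝔫 over k. Then the ideal 𝔪̃ + 𝔫̃ of R ⊗_k S equals the k-linear span of the set { a ⊗ b : a ∈ A, b ∈ B, and (a ∈ 𝔪 or b ∈ 𝔫) }. -/
open TensorProduct

/-- The ideal of `R ⊗[k] S` generated by the image of an ideal of `R`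
under `r ↦ r ⊗ 1`. -/
noncomputable def tildeLeft (k R S : Type*) [Field k] [CommRing R] [CommRing S]
    [Algebra k R] [Algebra k S] (a : Ideal R) : Ideal (R ⊗[k] S) :=
  a.map (Algebra.TensorProduct.includeLeft : R →ₐ[k] R ⊗[k] S)

/-- The ideal of `R ⊗[k] S` generated by the image of an ideal of `S`
under `s ↦ 1 ⊗ s`. -/
noncomputable def tildeRight (k R S : Type*) [Field k] [CommRing R] [CommRing S]
    [Algebra k R] [Algebra k S] (b : Ideal S) : Ideal (R ⊗[k] S) :=
  b.map (Algebra.TensorProduct.includeRight : S →ₐ[k] R ⊗[k] S)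

theorem TensorProduct.tmul_mem_of_mem_span {k M N : Type*} [CommSemiring k]
    [AddCommMonoid M] [AddCommMonoid N] [Module k M] [Module k N] {s : Set M} {t : Set N}
    {P : Submodule k (M ⊗[k] N)} (h : ∀ x ∈ s, ∀ y ∈ t, x ⊗ₜ[k] y ∈ P)
    {x : M} {y : N} (hx : x ∈ Submodule.span k s) (hy : y ∈ Submodule.span k t) :
    x ⊗ₜ[k] y ∈ P := by
  have hmem := Submodule.apply_mem_map₂ (TensorProduct.mk k M N) hx hy
  rw [Submodule.map₂_span_span] at hmem
  refine Submodule.span_le.2 ?_ hmem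
  rintro _ ⟨a, ha, b, hb, rfl⟩
  exact h a ha b hb

theorem restrictScalars_tildeLeft_le {k R S : Type*} [Field k] [CommRing R] [CommRing S]
    [Algebra k R] [Algebra k S] {I : Ideal R} {P : Submodule k (R ⊗[k] S)}
    (h : ∀ r ∈ I, ∀ s : S, r ⊗ₜ[k] s ∈ P) :
    Submodule.restrictScalars k (tildeLeft k R S I) ≤ P := by
  refine (Ideal.map_includeLeft_eq I).le.trans ?_
  rintro _ ⟨x, rfl⟩
  induction x with
  | zero => simp
  | add x y hx hy => rw [map_add]; exact add_mem hx hy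
  | tmul r s => exact h r r.2 s

theorem restrictScalars_tildeRight_le {k R S : Type*} [Field k] [CommRing R] [CommRing S]
    [Algebra k R] [Algebra k S] {J : Ideal S} {P : Submodule k (R ⊗[k] S)}
    (h : ∀ r : R, ∀ s ∈ J, r ⊗ₜ[k] s ∈ P) :
    Submodule.restrictScalars k (tildeRight k R S J) ≤ P := by
  refine (Ideal.map_includeRight_eq J).le.trans ?_
  rintro _ ⟨x, rfl⟩
  induction x with
  | zero => simp
  | add x y hx hy => rw [map_add]; exact add_mem hx hy
  | tmul r s => exact h r s s.2

theorem tmul_mem_tildeLeft {k R S : Type*} [Field k] [CommRing R] [CommRing S]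
    [Algebra k R] [Algebra k S] {I : Ideal R} {r : R} (hr : r ∈ I) (s : S) :
    r ⊗ₜ[k] s ∈ tildeLeft k R S I := by
  have h := Ideal.mul_mem_right (1 ⊗ₜ[k] s) _
    (Ideal.mem_map_of_mem (Algebra.TensorProduct.includeLeft : R →ₐ[k] R ⊗[k] S) hr)
  simpa [tildeLeft] using h

theorem tmul_mem_tildeRight {k R S : Type*} [Field k] [CommRing R] [CommRing S]
    [Algebra k R] [Algebra k S] {J : Ideal S} (r : R) {s : S} (hs : s ∈ J) :
    r ⊗ₜ[k] s ∈ tildeRight k R S J := by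
  have h := Ideal.mul_mem_left _ (r ⊗ₜ[k] 1)
    (Ideal.mem_map_of_mem (Algebra.TensorProduct.includeRight : S →ₐ[k] R ⊗[k] S) hs)
  simpa [tildeRight] using h

theorem sum_tilde_eq_span_basis_tensors (k R S : Type*) [Field k] [CommRing R] [CommRing S]
    [Algebra k R] [Algebra k S]
    (A : Set R) (B : Set S)
    (hAli : LinearIndependent k ((↑) : A → R))
    (hAsp : Submodule.span k A = ⊤)
    (hBli : LinearIndependent k ((↑) : B → S))
    (hBsp : Submodule.span k B = ⊤)
    (𝔪 : Ideal R) (𝔫 : Ideal S)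
    (hA𝔪 : Submodule.span k (A ∩ (𝔪 : Set R)) = Submodule.restrictScalars k 𝔪)
    (hB𝔫 : Submodule.span k (B ∩ (𝔫 : Set S)) = Submodule.restrictScalars k 𝔫) :
    Submodule.restrictScalars k (tildeLeft k R S 𝔪 + tildeRight k R S 𝔫) =
      Submodule.span k
        {x : R ⊗[k] S | ∃ a ∈ A, ∃ b ∈ B, (a ∈ 𝔪 ∨ b ∈ 𝔫) ∧ x = a ⊗ₜ[k] b} := by
  apply le_antisymm
  · rw [Submodule.add_eq_sup, Submodule.restrictScalars_sup]
    refine sup_le (restrictScalars_tildeLeft_le fun r hr s => ?_)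
      (restrictScalars_tildeRight_le fun r s hs => ?_)
    · have hr' : r ∈ Submodule.span k (A ∩ (𝔪 : Set R)) := hA𝔪 ▸ hr
      have hs' : s ∈ Submodule.span k B := hBsp ▸ Submodule.mem_top
      refine TensorProduct.tmul_mem_of_mem_span (fun a ha b hb => ?_) hr' hs'
      exact Submodule.subset_span ⟨a, ha.1, b, hb, Or.inl ha.2, rfl⟩
    · have hr' : r ∈ Submodule.span k A := hAsp ▸ Submodule.mem_top
      have hs' : s ∈ Submodule.span k (B ∩ (𝔫 : Set S)) := hB𝔫 ▸ hs
      refine TensorProduct.tmul_mem_of_mem_span (fun a ha b hb => ?_) hr' hs'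
      exact Submodule.subset_span ⟨a, ha, b, hb.1, Or.inr hb.2, rfl⟩
  · refine Submodule.span_le.2 ?_
    rintro _ ⟨a, -, b, -, ha | hb, rfl⟩
    · exact Ideal.mem_sup_left (tmul_mem_tildeLeft ha b)
    · exact Ideal.mem_sup_right (tmul_mem_tildeRight a hb)
end

section
/- Let i ≥ 0 be a natural number, 𝔪_0 ⊇ 𝔪_1 ⊇ … ⊇ 𝔪_{i+1} a descending chain of ideals of R with 𝔪_0 = R, and 𝔫_0 ⊇ 𝔫_1 ⊇ … ⊇ 𝔫_{i+1} a descending chain of ideals of S with 𝔫_0 = S. Suppose A is a k-basis of R such that for every 0 ≤ j ≤ i+1 the subset A ∩ 𝔪_j spans 𝔪_j over k, and B is a k-basis of S such that for every j the subset B ∩ 𝔫_j spans 𝔫_j. For a ∈ A set ord(a) := max{ j ∈ {0,…,i+1} : a ∈ 𝔪_j }, and define ord(b) for b ∈ B analogously using the 𝔫_j. Then the ideal ⋂_{j=1}^{i+1} (𝔪̃_j + 𝔫̃_{i+2−j}) of R ⊗_k S equals the k-linear span of the set { a ⊗ b : a ∈ A, b ∈ B, ord(a) + ord(b) ≥ i+1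 }. -/
open TensorProduct

/-- `ord x = max { j ∈ {0,…,N} : x ∈ m j }`, the order of an element with respect to
a chain of ideals (well defined when `m 0 = ⊤`). -/
noncomputable def chainOrd {R : Type*} [CommRing R] (m : ℕ → Ideal R) (N : ℕ) (x : R) : ℕ :=
  sSup {j : ℕ | j ≤ N ∧ x ∈ m j}

open Submodule in
/-- If `A ∩ I` spans the ideal `I` and `B` spans `S`, then the extension of `I` to `R ⊗[k] S`
is spanned by the pure tensors `a ⊗ₜ b` with `a ∈ A ∩ I` and `b ∈ B`. -/
lemma restrictScalars_tildeLeft_eq_span {k R S : Type*} [Field k] [CommRing R] [CommRing S]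
    [Algebra k R] [Algebra k S] {A : Set R} {B : Set S} {I : Ideal R}
    (hA : span k (A ∩ (I : Set R)) = restrictScalars k I) (hB : span k B = ⊤) :
    restrictScalars k (tildeLeft k R S I) =
      span k (Set.image2 (fun a b ↦ a ⊗ₜ[k] b) (A ∩ (I : Set R)) B) := by
  have h := map₂_span_span k (TensorProduct.mk k R S) (A ∩ (I : Set R)) B
  apply le_antisymm
  · refine (Ideal.map_includeLeft_eq I).le.trans ?_
    rintro _ ⟨y, rfl⟩
    induction y with
    | zero => simp
    | add x y hx hy => rw [map_add]; exact add_mem hx hy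
    | tmul x s =>
      refine h.le (apply_mem_map₂ _ ?_ (hB ▸ mem_top))
      exact hA.ge x.2
  · rw [span_le]
    rintro _ ⟨a, ha, b, -, rfl⟩
    have : a ⊗ₜ[k] b = (1 ⊗ₜ b) * Algebra.TensorProduct.includeLeft (S := k) a := by simp
    refine this.symm.subst (motive := (· ∈ tildeLeft k R S I)) ?_
    exact Ideal.mul_mem_left _ _ (Ideal.mem_map_of_mem _ ha.2)

open Submodule in
/-- If `B ∩ I` spans the ideal `I` and `A` spans `R`, then the extension of `I` to `R ⊗[k] S`
is spanned by the pure tensors `a ⊗ₜ b` with `a ∈ A` and `b ∈ B ∩ I`. -/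
lemma restrictScalars_tildeRight_eq_span {k R S : Type*} [Field k] [CommRing R] [CommRing S]
    [Algebra k R] [Algebra k S] {A : Set R} {B : Set S} {I : Ideal S}
    (hA : span k A = ⊤) (hB : span k (B ∩ (I : Set S)) = restrictScalars k I) :
    restrictScalars k (tildeRight k R S I) =
      span k (Set.image2 (fun a b ↦ a ⊗ₜ[k] b) A (B ∩ (I : Set S))) := by
  have h := map₂_span_span k (TensorProduct.mk k R S) A (B ∩ (I : Set S))
  apply le_antisymm
  · refine (Ideal.map_includeRight_eq I).le.trans ?_
    rintro _ ⟨y, rfl⟩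
    induction y with
    | zero => simp
    | add x y hx hy => rw [map_add]; exact add_mem hx hy
    | tmul x s =>
      refine h.le (apply_mem_map₂ _ (hA ▸ mem_top) ?_)
      exact hB.ge s.2
  · rw [span_le]
    rintro _ ⟨a, -, b, hb, rfl⟩
    have : a ⊗ₜ[k] b = (a ⊗ₜ 1) * Algebra.TensorProduct.includeRight b := by simp
    refine this.symm.subst (motive := (· ∈ tildeRight k R S I)) ?_
    exact Ideal.mul_mem_left _ _ (Ideal.mem_map_of_mem _ hb.2)

lemma le_chainOrd_iff {R : Type*} [CommRing R] {m : ℕ → Ideal R} {N : ℕ}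
    (hm : ∀ j j' : ℕ, j ≤ j' → j' ≤ N → m j' ≤ m j) (hm0 : m 0 = ⊤) {j : ℕ} (hj : j ≤ N) (x : R) :
    j ≤ chainOrd m N x ↔ x ∈ m j := by
  have hb : BddAbove {j : ℕ | j ≤ N ∧ x ∈ m j} := ⟨N, fun _ h ↦ h.1⟩
  have hs := Nat.sSup_mem (s := {j : ℕ | j ≤ N ∧ x ∈ m j}) ⟨0, Nat.zero_le _, by simp [hm0]⟩ hb
  exact ⟨fun h ↦ hm _ _ h hs.1 hs.2, fun h ↦ le_csSup hb ⟨hj, h⟩⟩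

lemma chainOrd_add_chainOrd_ge_iff {R S : Type*} [CommRing R] [CommRing S] {i : ℕ}
    {m : ℕ → Ideal R} {n : ℕ → Ideal S}
    (hm : ∀ j j' : ℕ, j ≤ j' → j' ≤ i + 1 → m j' ≤ m j) (hm0 : m 0 = ⊤)
    (hn : ∀ j j' : ℕ, j ≤ j' → j' ≤ i + 1 → n j' ≤ n j) (hn0 : n 0 = ⊤) (a : R) (b : S) :
    i + 1 ≤ chainOrd m (i + 1) a + chainOrd n (i + 1) b ↔
      ∀ j ∈ Finset.Icc 1 (i + 1), a ∈ m j ∨ b ∈ n (i + 2 - j) := by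
  have key : ∀ j ∈ Finset.Icc 1 (i + 1), (a ∈ m j ∨ b ∈ n (i + 2 - j) ↔
      j ≤ chainOrd m (i + 1) a ∨ i + 2 - j ≤ chainOrd n (i + 1) b) := fun j hj ↦ by
    rw [Finset.mem_Icc] at hj
    rw [le_chainOrd_iff hm hm0 hj.2, le_chainOrd_iff hn hn0 (by omega)]
  rw [forall₂_congr key]
  simp only [Finset.mem_Icc]
  refine ⟨fun h j hj ↦ by omega, fun h ↦ ?_⟩
  by_cases hp : i + 1 ≤ chainOrd m (i + 1) a
  · omega
  · have := h (chainOrd m (i + 1) a + 1) (by omega)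
    omega

theorem inf_tilde_eq_span_ord_ge (k R S : Type*) [Field k] [CommRing R] [CommRing S]
    [Algebra k R] [Algebra k S] (i : ℕ)
    (m : ℕ → Ideal R) (n : ℕ → Ideal S)
    (hm : ∀ j j' : ℕ, j ≤ j' → j' ≤ i + 1 → m j' ≤ m j) (hm0 : m 0 = ⊤)
    (hn : ∀ j j' : ℕ, j ≤ j' → j' ≤ i + 1 → n j' ≤ n j) (hn0 : n 0 = ⊤)
    (A : Set R) (B : Set S)
    (hAli : LinearIndependent k ((↑) : A → R))
    (hAsp : Submodule.span k A = ⊤)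
    (hBli : LinearIndependent k ((↑) : B → S))
    (hBsp : Submodule.span k B = ⊤)
    (hAm : ∀ j ≤ i + 1,
      Submodule.span k (A ∩ (m j : Set R)) = Submodule.restrictScalars k (m j))
    (hBn : ∀ j ≤ i + 1,
      Submodule.span k (B ∩ (n j : Set S)) = Submodule.restrictScalars k (n j)) :
    Submodule.restrictScalars k
        (⨅ j ∈ Finset.Icc 1 (i + 1),
          tildeLeft k R S (m j) + tildeRight k R S (n (i + 2 - j))) =
      Submodule.span k
        {x : R ⊗[k] S | ∃ a ∈ A, ∃ b ∈ B,
          i + 1 ≤ chainOrd m (i + 1) a + chainOrd n (i + 1) b ∧ x = a ⊗ₜ[k] b} := by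
  let C := (Module.Basis.mk hAli (by simp [hAsp])).tensorProduct
    (Module.Basis.mk hBli (by simp [hBsp]))
  have hC : ∀ p, C p = (p.1 : R) ⊗ₜ[k] (p.2 : S) := fun p ↦ by
    simp [C, Module.Basis.tensorProduct_apply']
  have hsum : ∀ j ∈ Finset.Icc 1 (i + 1), Submodule.restrictScalars k
      (tildeLeft k R S (m j) + tildeRight k R S (n (i + 2 - j))) =
        Submodule.span k (C '' {p | (p.1 : R) ∈ m j ∨ (p.2 : S) ∈ n (i + 2 - j)}) := by
    intro j hj
    rw [Finset.mem_Icc] at hj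
    rw [Submodule.add_eq_sup, Submodule.restrictScalars_sup,
      restrictScalars_tildeLeft_eq_span (hAm j hj.2) hBsp,
      restrictScalars_tildeRight_eq_span hAsp (hBn (i + 2 - j) (by omega)),
      ← Submodule.span_union]
    congr 1
    ext x
    simp only [Set.mem_union, Set.mem_image2, Set.mem_image, Set.mem_ofPred_eq, hC, Prod.exists,
      Subtype.exists, Set.mem_inter_iff, SetLike.mem_coe]
    grind
  have hspan : {x : R ⊗[k] S | ∃ a ∈ A, ∃ b ∈ B,
      i + 1 ≤ chainOrd m (i + 1) a + chainOrd n (i + 1) b ∧ x = a ⊗ₜ[k] b} =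
      C '' {p | ∀ j ∈ Finset.Icc 1 (i + 1), (p.1 : R) ∈ m j ∨ (p.2 : S) ∈ n (i + 2 - j)} := by
    ext x
    simp only [chainOrd_add_chainOrd_ge_iff hm hm0 hn hn0, Set.mem_image, Set.mem_ofPred_eq, hC,
      Prod.exists, Subtype.exists]
    grind
  ext x
  rw [hspan, C.mem_span_image, Submodule.restrictScalars_mem]
  simp only [Submodule.mem_iInf]
  have hx : ∀ j ∈ Finset.Icc 1 (i + 1),
      (x ∈ tildeLeft k R S (m j) + tildeRight k R S (n (i + 2 - j)) ↔
        ↑(C.repr x).support ⊆ {p : A × B | (p.1 : R) ∈ m j ∨ (p.2 : S) ∈ n (i + 2 - j)}) :=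
    fun j hj ↦ by rw [← C.mem_span_image, ← hsum j hj, Submodule.restrictScalars_mem]
  rw [forall₂_congr hx]
  exact ⟨fun h p hp j hj ↦ h j hj hp, fun h j hj p hp ↦ h hp j hj⟩
end

section
/- Let σ and τ be types, let P be the multivariate polynomial ring over k in variables indexed by the disjoint union σ ⊕ τ, let I ⊆ P be the ideal generated by the variables indexed by σ, and J ⊆ P the ideal generated by the variables indexed by τ. Then for every natural number i ≥ 0: (I + J)^{i+1} = ⋂_{j=1}^{i+1} (I^j + J^{i+2−j}). -/
open MvPolynomial

/-- Every monomial of an element of the `n`-th power of an ideal generated by variables of positive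
weight has weight at least `n`. -/
theorem le_weight_of_mem_span_X_image_pow {α R : Type*} [CommSemiring R] (w : α → ℕ) {s : Set α}
    (hs : ∀ a ∈ s, 1 ≤ w a) {n : ℕ} {p : MvPolynomial α R}
    (hp : p ∈ Ideal.span (X '' s : Set (MvPolynomial α R)) ^ n) {m : α →₀ ℕ}
    (hm : m ∈ p.support) : n ≤ Finsupp.weight w m := by
  classical
  induction n generalizing p m with
  | zero => exact Nat.zero_le _
  | succ n ih =>
    rw [pow_succ] at hp
    induction hp using Submodule.mul_induction_on' generalizing m with
    | mem_mul_mem q hq r hr =>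
      obtain ⟨a, ha, b, hb, rfl⟩ := Finset.mem_add.mp (support_mul q r hm)
      obtain ⟨x, hx, hbx⟩ := mem_ideal_span_X_image.mp hr b hb
      have hwx := Finsupp.le_weight_of_ne_zero' w hbx
      have := hs x hx
      have := ih hq ha
      rw [map_add]
      omega
    | add q _ r _ hq hr =>
      rcases Finset.mem_union.mp (support_add hm) with h | h
      · exact hq h
      · exact hr h

theorem Ideal.add_pow_le_pow_add_pow {R : Type*} [CommSemiring R] (I J : Ideal R) {a b n : ℕ}
    (h : a + b ≤ n + 1) : (I + J) ^ n ≤ I ^ a + J ^ b := by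
  rw [add_pow, Ideal.sum_eq_sup, Ideal.add_eq_sup]
  refine Finset.sup_le fun m _ => Ideal.mul_le_left.trans ?_
  rcases le_or_gt a m with h' | h'
  · exact Ideal.mul_le_left.trans (le_sup_of_le_left (Ideal.pow_le_pow_right h'))
  · exact Ideal.mul_le_right.trans (le_sup_of_le_right (Ideal.pow_le_pow_right (by omega)))

theorem pow_sum_eq_iInf_pow_add_pow (k : Type*) [Field k] (σ τ : Type*) (i : ℕ)
    (I J : Ideal (MvPolynomial (σ ⊕ τ) k))
    (hI : I = Ideal.span (Set.range fun s : σ => (X (Sum.inl s) : MvPolynomial (σ ⊕ τ) k)))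
    (hJ : J = Ideal.span (Set.range fun t : τ => (X (Sum.inr t) : MvPolynomial (σ ⊕ τ) k))) :
    (I + J) ^ (i + 1) = ⨅ j ∈ Finset.Icc 1 (i + 1), I ^ j + J ^ (i + 2 - j) := by
  classical
  refine le_antisymm (le_iInf₂ fun j hj => ?_) fun p hp => ?_
  · rw [Finset.mem_Icc] at hj
    exact Ideal.add_pow_le_pow_add_pow I J (by omega)
  have hI' : I = Ideal.span (X '' Set.range Sum.inl) := by rw [hI, ← Set.range_comp]; rfl
  have hJ' : J = Ideal.span (X '' Set.range Sum.inr) := by rw [hJ, ← Set.range_comp]; rfl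
  have hIJ : I + J = idealOfVars (σ ⊕ τ) k := by
    rw [hI', hJ', Ideal.add_eq_sup, ← Ideal.span_union, ← Set.image_union,
      Set.range_inl_union_range_inr, Set.image_univ, idealOfVars]
  rw [hIJ, mem_pow_idealOfVars_iff]
  intro m hm
  let u : σ ⊕ τ → ℕ := Sum.elim 1 0
  let v : σ ⊕ τ → ℕ := Sum.elim 0 1
  have hdeg : m.degree = Finsupp.weight u m + Finsupp.weight v m := by
    simp only [Finsupp.weight_apply, Finsupp.degree_apply, Finsupp.sum, ← Finset.sum_add_distrib]
    refine Finset.sum_congr rfl fun x _ => ?_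
    rcases x with x | x <;> simp [u, v]
  by_contra! hlt
  obtain ⟨q, hq, r, hr, rfl⟩ := Submodule.mem_sup.mp <| (Submodule.mem_iInf _).mp
    ((Submodule.mem_iInf _).mp hp (Finsupp.weight u m + 1)) (Finset.mem_Icc.mpr (by omega))
  rw [hI'] at hq
  rw [hJ'] at hr
  rcases Finset.mem_union.mp (support_add hm) with h | h
  · have := le_weight_of_mem_span_X_image_pow u (by simp [u]) hq h
    omega
  · have := le_weight_of_mem_span_X_image_pow v (by simp [v]) hr h
    omega
end

section
/- Let A and B be commutative k-algebras and let B be an A-algebra (with compatible k-algebra structures) that is étale over A, i.e. formally étale and of finite presentation. Let I ⊆ A ⊗_k A be the kernel of the multiplication map A ⊗_k A → A, and J ⊆ B ⊗_k B the kernel of the multiplication map B ⊗_k B → B. Regard (A ⊗_k A)/I^{n+1} as an A-algebra via the first tensor factor. Then for every natural number n, the natural B-algebra homomorphism B ⊗_A ((A ⊗_k A)/I^{n+1}) → (B ⊗_k B)/J^{n+1}, determined by b ⊗ [x ⊗ y] ↦ [(b·f(x)) ⊗ f(y)] where f : A → B is the structure map, is bijective. -/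
open TensorProduct

universe u

theorem Algebra.FormallySmooth.exists_ringHom_section {A B C : Type*} [CommRing A] [CommRing B]
    [CommRing C] [Algebra A B] [Algebra.FormallySmooth A B] (ι : A →+* C) (π : C →+* B)
    (hπ : Function.Surjective π) (hnil : IsNilpotent (RingHom.ker π))
    (hι : π.comp ι = algebraMap A B) :
    ∃ h : B →+* C, h.comp (algebraMap A B) = ι ∧ π.comp h = RingHom.id B := by
  let _ := ι.toAlgebra
  let π' : C →ₐ[A] B := { π with commutes' := fun a => RingHom.congr_fun hι a }
  let h := Algebra.FormallySmooth.liftOfSurjective (AlgHom.id A B) π' hπ hnil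
  refine ⟨h, h.comp_algebraMap, ?_⟩
  ext b
  exact Algebra.FormallySmooth.liftOfSurjective_apply (AlgHom.id A B) π' hπ hnil b

theorem Algebra.FormallyUnramified.ringHom_ext_of_isNilpotent_ker {A B C E : Type*} [CommRing A]
    [CommRing B] [CommRing C] [CommRing E] [Algebra A B] [Algebra.FormallyUnramified A B]
    (ε : C →+* E) (hnil : IsNilpotent (RingHom.ker ε)) {h₁ h₂ : B →+* C}
    (hA : h₁.comp (algebraMap A B) = h₂.comp (algebraMap A B))
    (hε : ε.comp h₁ = ε.comp h₂) : h₁ = h₂ := by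
  let _ := (h₁.comp (algebraMap A B)).toAlgebra
  let f₁ : B →ₐ[A] C := { h₁ with commutes' := fun _ => rfl }
  let f₂ : B →ₐ[A] C := { h₂ with commutes' := fun a => (RingHom.congr_fun hA a).symm }
  have key : f₁ = f₂ := Algebra.FormallyUnramified.ext (RingHom.ker ε) hnil fun b => by
    rw [Ideal.Quotient.eq, RingHom.mem_ker, map_sub, sub_eq_zero]
    exact RingHom.congr_fun hε b
  ext b
  exact DFunLike.congr_fun key b

/-- For `B` étale over `A`, the `n`-th order infinitesimal neighborhood `D` of the diagonal of `B`
is the base change of the one `Q` of `A`. -/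
theorem Algebra.Etale.exists_bijective_infinitesimal_neighborhood {k A B Q D : Type*} [CommRing k]
    [CommRing A] [CommRing B] [CommRing Q] [CommRing D] [Algebra k A] [Algebra k B] [Algebra A B]
    [IsScalarTower k A B] [Algebra A Q] [Algebra A D] [Algebra.Etale A B] (n : ℕ)
    (p : A ⊗[k] A →ₐ[A] Q) (hp : Function.Surjective p)
    (hpker : RingHom.ker p =
      RingHom.ker (Algebra.TensorProduct.lmul' k : A ⊗[k] A →ₐ[k] A) ^ (n + 1))
    (r : B ⊗[k] B →ₐ[A] D) (hr : Function.Surjective r)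
    (hrker : RingHom.ker r =
      RingHom.ker (Algebra.TensorProduct.lmul' k : B ⊗[k] B →ₐ[k] B) ^ (n + 1)) :
    ∃ g : B ⊗[A] Q →+* D,
      (∀ (b : B) (x y : A), g (b ⊗ₜ[A] p (x ⊗ₜ[k] y)) =
        r ((b * algebraMap A B x) ⊗ₜ[k] algebraMap A B y)) ∧
      Function.Bijective g := by
  set I := RingHom.ker (Algebra.TensorProduct.lmul' k : A ⊗[k] A →ₐ[k] A) with hI
  set J := RingHom.ker (Algebra.TensorProduct.lmul' k : B ⊗[k] B →ₐ[k] B) with hJ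
  let f : A →ₐ[k] B := IsScalarTower.toAlgHom k A B
  -- the map `f ⊗ f`
  let ff : A ⊗[k] A →ₐ[A] B ⊗[k] B :=
    Algebra.TensorProduct.lift (Algebra.ofId A _)
      (Algebra.TensorProduct.includeRight.comp f) (fun _ _ => Commute.all _ _)
  have hff (x y : A) : ff (x ⊗ₜ y) = f x ⊗ₜ f y := by
    simp [ff, f, Algebra.ofId_apply, Algebra.TensorProduct.algebraMap_apply]
  have hffmul (q : A ⊗[k] A) : Algebra.TensorProduct.lmul' k (ff q) =
      f (Algebra.TensorProduct.lmul' k q) := by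
    induction q with
    | zero => simp
    | add x y hx hy => simp only [map_add, hx, hy]
    | tmul x y => simp [hff]
  have hffI : I ≤ J.comap ff := fun q hq => by
    rw [hI, RingHom.mem_ker] at hq
    rw [Ideal.mem_comap, hJ, RingHom.mem_ker, hffmul, hq, map_zero]
  have hffIn : I ^ (n + 1) ≤ (J ^ (n + 1)).comap ff :=
    (Ideal.pow_right_mono hffI _).trans (Ideal.le_comap_pow _ _)
  let gr : Q →ₐ[A] D := AlgHom.liftOfSurjective p hp (r.comp ff) fun q hq => by
    change q ∈ RingHom.ker p at hq
    change ff q ∈ RingHom.ker r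
    rw [hpker] at hq
    rw [hrker]
    exact hffIn hq
  have hgr (q : A ⊗[k] A) : gr (p q) = r (ff q) :=
    AlgHom.liftOfSurjective_apply _ _ _ _ _
  let g : B ⊗[A] Q →ₐ[A] D :=
    Algebra.TensorProduct.lift
      (r.comp (Algebra.TensorProduct.includeLeft : B →ₐ[A] B ⊗[k] B)) gr
      (fun _ _ => Commute.all _ _)
  have hg (b : B) (q : A ⊗[k] A) : g (b ⊗ₜ p q) = r ((b ⊗ₜ 1) * ff q) := by
    simp [g, hgr]
  -- the augmentations of both sides to `B`
  let ε : D →+* B :=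
    RingHom.liftOfSurjective r.toRingHom hr ⟨(Algebra.TensorProduct.lmul' k).toRingHom, fun q hq => by
      have : q ∈ J ^ (n + 1) := hrker ▸ hq
      exact Ideal.pow_le_self n.succ_ne_zero this⟩
  have hε (q : B ⊗[k] B) : ε (r q) = Algebra.TensorProduct.lmul' k q :=
    RingHom.liftOfRightInverse_comp_apply _ _ _ _ _
  have hεnil : IsNilpotent (RingHom.ker ε) := by
    refine ⟨n + 1, le_bot_iff.mp (?_ : _ ≤ ⊥)⟩
    have : RingHom.ker ε ≤ J.map r := fun x hx => by
      obtain ⟨q, rfl⟩ := hr x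
      refine Ideal.mem_map_of_mem _ ?_
      rwa [RingHom.mem_ker, hε] at hx
    refine (Ideal.pow_right_mono this _).trans ?_
    rw [← Ideal.map_pow, ← hrker]
    exact (Ideal.map_le_iff_le_comap.mpr le_rfl)
  let π : B ⊗[A] Q →+* B := ε.comp g.toRingHom
  have hπ (b : B) (q : A ⊗[k] A) : π (b ⊗ₜ p q) = b * f (Algebra.TensorProduct.lmul' k q) := by
    change ε (g _) = _
    rw [hg, hε, map_mul, hffmul]
    simp
  let N : Ideal (B ⊗[A] Q) := (I.map p).map Algebra.TensorProduct.includeRight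
  have hN (x : B ⊗[A] Q) : x - π x ⊗ₜ 1 ∈ N := by
    induction x with
    | zero => simp
    | add x y hx hy =>
      rw [map_add, TensorProduct.add_tmul, add_sub_add_comm]
      exact add_mem hx hy
    | tmul b z =>
      obtain ⟨q, rfl⟩ := hp z
      have hq : q - algebraMap A _ (Algebra.TensorProduct.lmul' k q) ∈ I := by
        rw [hI, RingHom.mem_ker]
        simp [Algebra.TensorProduct.algebraMap_apply]
      have h1 : (b * f (Algebra.TensorProduct.lmul' k q)) ⊗ₜ[A]
          (1 : Q) = b ⊗ₜ p
            (algebraMap A (A ⊗[k] A) (Algebra.TensorProduct.lmul' k q)) := by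
        rw [show b * f (Algebra.TensorProduct.lmul' k q) =
          Algebra.TensorProduct.lmul' k q • b by rw [Algebra.smul_def, mul_comm]; rfl,
          TensorProduct.smul_tmul, Algebra.smul_def, mul_one, p.commutes]
      rw [hπ, h1, ← TensorProduct.tmul_sub, ← map_sub,
        show ∀ z : Q, b ⊗ₜ[A] z = (b ⊗ₜ 1) * (1 ⊗ₜ z) by simp]
      exact Ideal.mul_mem_left _ _ (Ideal.mem_map_of_mem _ (Ideal.mem_map_of_mem _ hq))
  have hkerπ : RingHom.ker π ^ (n + 1) = ⊥ := by
    refine le_bot_iff.mp ((Ideal.pow_right_mono (fun x hx => ?_) _ : _ ≤ N ^ (n + 1)).trans ?_)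
    · simpa [RingHom.mem_ker.mp hx] using hN x
    · rw [← Ideal.map_pow, ← Ideal.map_pow, ← hpker]
      exact (Ideal.map_mono (Ideal.map_le_iff_le_comap.mpr le_rfl)).trans_eq Ideal.map_bot
  -- the second projection of the inverse
  let ι : A →+* B ⊗[A] Q :=
    (Algebra.TensorProduct.includeRight : _ →ₐ[A] B ⊗[A] Q).toRingHom.comp
      (p.toRingHom.comp
        (Algebra.TensorProduct.includeRight : A →ₐ[k] A ⊗[k] A).toRingHom)
  have hι (y : A) : ι y = 1 ⊗ₜ p (1 ⊗ₜ y) := rfl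
  obtain ⟨h, hhA, hhπ⟩ := Algebra.FormallySmooth.exists_ringHom_section (A := A) ι π
    (fun b => ⟨b ⊗ₜ p 1, by rw [hπ]; simp⟩) ⟨n + 1, hkerπ⟩
    (by ext y; rw [RingHom.comp_apply, hι, hπ]; simp [f])
  replace hhA (a : A) : h (f a) = ι a := RingHom.congr_fun hhA a
  replace hhπ (b : B) : π (h b) = b := RingHom.congr_fun hhπ b
  have hgh (b : B) : g (h b) = r (1 ⊗ₜ b) := by
    refine RingHom.congr_fun (Algebra.FormallyUnramified.ringHom_ext_of_isNilpotent_ker (A := A)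
      ε hεnil (h₁ := g.toRingHom.comp h) (h₂ := r.toRingHom.comp
        (Algebra.TensorProduct.includeRight : B →ₐ[k] B ⊗[k] B).toRingHom) ?_ ?_) b
    · ext a
      change g (h (f a)) = r (1 ⊗ₜ f a)
      rw [hhA, hι, hg, hff]
      simp
    · ext b
      change π (h b) = ε (r (1 ⊗ₜ b))
      rw [hhπ, hε]
      simp
  have hkh (c : k) : h (algebraMap k B c) = algebraMap k B c ⊗ₜ 1 := by
    rw [IsScalarTower.algebraMap_apply k A B]
    refine (hhA _).trans ?_
    rw [hι, ← Algebra.TensorProduct.algebraMap_apply' c, Algebra.TensorProduct.algebraMap_apply]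
    rw [← mul_one (algebraMap A B _), ← Algebra.smul_def, TensorProduct.smul_tmul,
      Algebra.smul_def, mul_one]
    exact congrArg _ (p.commutes _)
  let hk : B →ₐ[k] B ⊗[A] Q := { h with commutes' := hkh }
  let φ : B ⊗[k] B →ₐ[k] B ⊗[A] Q :=
    Algebra.TensorProduct.lift Algebra.TensorProduct.includeLeft hk (fun _ _ => Commute.all _ _)
  have hφ (b b' : B) : φ (b ⊗ₜ b') = b ⊗ₜ 1 * h b' := rfl
  have hgφ (q : B ⊗[k] B) : g (φ q) = r q := by
    induction q with
    | zero => simp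
    | add x y hx hy => simp only [map_add, hx, hy]
    | tmul b b' =>
      rw [hφ, map_mul, hgh, ← map_one p, hg, ← map_mul]
      simp
  have hφJ : J ^ (n + 1) ≤ RingHom.ker φ := by
    have : J ≤ (RingHom.ker π).comap φ := fun q hq => by
      change ε (g (φ q)) = 0
      rw [hgφ, hε]
      rwa [hJ] at hq
    refine (Ideal.pow_right_mono this _).trans ((Ideal.le_comap_pow _ _).trans ?_)
    rw [hkerπ]
    rfl
  let ψ : D →+* B ⊗[A] Q :=
    RingHom.liftOfSurjective r.toRingHom hr ⟨φ.toRingHom, hrker.trans_le hφJ⟩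
  have hψ (q : B ⊗[k] B) : ψ (r q) = φ q :=
    RingHom.liftOfRightInverse_comp_apply _ _ _ _ _
  have hφff (q : A ⊗[k] A) : φ (ff q) = 1 ⊗ₜ p q := by
    induction q with
    | zero => simp
    | add x y hx hy => simp only [map_add, hx, hy, TensorProduct.tmul_add]
    | tmul x y =>
      rw [hff, hφ, hhA, hι, Algebra.TensorProduct.tmul_mul_tmul, one_mul, mul_one,
        show f x = x • (1 : B) by rw [Algebra.smul_def, mul_one]; rfl, TensorProduct.smul_tmul,
        ← map_smul, TensorProduct.smul_tmul', smul_eq_mul, mul_one]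
  refine ⟨g.toRingHom, fun b x y => ?_, Function.bijective_iff_has_inverse.mpr ⟨ψ, ?_, ?_⟩⟩
  · refine (hg _ _).trans ?_
    rw [hff, Algebra.TensorProduct.tmul_mul_tmul, one_mul]
    rfl
  · intro x
    change ψ (g x) = x
    induction x with
    | zero => simp
    | add x y hx hy => simp only [map_add, hx, hy]
    | tmul b z =>
      obtain ⟨q, rfl⟩ := hp z
      rw [hg, hψ, map_mul, hφff, hφ]
      simp
  · intro x
    obtain ⟨q, rfl⟩ := hr x
    change g (ψ (r q)) = r q
    rw [hψ, hgφ]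

theorem etale_infinitesimal_neighborhood_base_change
    (k : Type*) (A B : Type u) [Field k] [CommRing A] [CommRing B]
    [Algebra k A] [Algebra k B] [Algebra A B] [IsScalarTower k A B]
    [Algebra.Etale A B] (n : ℕ)
    (I : Ideal (A ⊗[k] A)) (J : Ideal (B ⊗[k] B))
    (hI : I = RingHom.ker (Algebra.TensorProduct.lmul' k : A ⊗[k] A →ₐ[k] A))
    (hJ : J = RingHom.ker (Algebra.TensorProduct.lmul' k : B ⊗[k] B →ₐ[k] B)) :
    ∃ g : B ⊗[A] ((A ⊗[k] A) ⧸ I ^ (n + 1)) →+* (B ⊗[k] B) ⧸ J ^ (n + 1),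
      (∀ (b : B) (x y : A),
        g (b ⊗ₜ[A] (Ideal.Quotient.mk (I ^ (n + 1)) (x ⊗ₜ[k] y))) =
          Ideal.Quotient.mk (J ^ (n + 1))
            ((b * algebraMap A B x) ⊗ₜ[k] algebraMap A B y)) ∧
      Function.Bijective g := by
  subst hI hJ
  exact Algebra.Etale.exists_bijective_infinitesimal_neighborhood n
    (Ideal.Quotient.mkₐ A _) (Ideal.Quotient.mkₐ_surjective A _) (Ideal.Quotient.mkₐ_ker A _)
    (Ideal.Quotient.mkₐ A _) (Ideal.Quotient.mkₐ_surjective A _) (Ideal.Quotient.mkₐ_ker A _)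
end
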